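/- Let k ≥ 0 and k+1 ≤ l ≤ n+k. The number of parking functions α of length n with n+k spaces satisfying a_1 = l, τ_α = l − h_α, n_α = 1 and h_α = k equals C(n−1, l−k−1) · p_{l−k−1, l−1; ≤ l−1} · p_{n+k−l}, where C(a,b) is the binomial coefficient. -/

import Mathlib

/-- One parking step: a car with preference `a` parks in the first unoccupied
space `j` with `a ≤ j ≤ m`, if such a space exists; otherwise it leaves. -/
def parkStep (m : ℕ) (occ : Finset ℕ) (a : ℕ) : Finset ℕ :=
  if h : ((Finset.Icc a m) \ occ).Nonempty then
    insert (((Finset.Icc a m) \ occ).min' h) occ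
  else occ

/-- The set of occupied spaces after the cars with preference list `l`
(in order of arrival) have tried to park among spaces `1, …, m`. -/
def occupied (m : ℕ) (l : List ℕ) : Finset ℕ := l.foldl (parkStep m) ∅

/-- The number of cars that leave unparked. -/
def flaws (m : ℕ) (l : List ℕ) : ℕ := l.length - (occupied m l).card

/-- The preference list (with entries in `[1, s]`) encoded by a function `Fin n → Fin s`. -/
def prefList {n s : ℕ} (f : Fin n → Fin s) : List ℕ :=
  (List.ofFn f).map (fun i => (i : ℕ) + 1)

/-- `p n m s k` is the number of `k`-flaw preference sets of length `n` with `m`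
parking spaces, all of whose entries are at most `s`. -/
def p (n m s k : ℕ) : ℕ :=
  (Finset.univ.filter (fun f : Fin n → Fin s => flaws m (prefList f) = k)).card

/-- `pL n m s k l` is the number of `k`-flaw preference sets of length `n` with `m`
parking spaces, entries at most `s`, and first entry `l`. -/
def pL (n m s k l : ℕ) : ℕ :=
  (Finset.univ.filter (fun f : Fin n → Fin s =>
    flaws m (prefList f) = k ∧ (prefList f).head? = some l)).card

/-- The set of empty spaces. -/
def empties (m : ℕ) (l : List ℕ) : Finset ℕ := Finset.Icc 1 m \ occupied m l

/-- `n_α`: the number of entries equal to the first entry. -/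
def nstat (l : List ℕ) : ℕ := l.count l.headI

/-- `h_α`: the number of empty spaces smaller than the first entry. -/
def hstat (m : ℕ) (l : List ℕ) : ℕ := ((empties m l).filter (fun x => x < l.headI)).card

/-- `τ_α`: the number of entries smaller than the first entry, plus one. -/
def taustat (l : List ℕ) : ℕ := l.countP (fun a => a < l.headI) + 1

/-- `m_α`: the largest empty space. -/
def mstat (m : ℕ) (l : List ℕ) : ℕ := (empties m l).sup id

theorem parkStep_full (m : ℕ) (occ : Finset ℕ) (a : ℕ)
    (h : ∀ j, a ≤ j → j ≤ m → j ∈ occ) : parkStep m occ a = occ := by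
  unfold parkStep
  rw [dif_neg]
  rintro ⟨x, hx⟩
  simp only [Finset.mem_sdiff, Finset.mem_Icc] at hx
  exact hx.2 (h x hx.1.1 hx.1.2)

theorem parkStep_insert (m : ℕ) (occ : Finset ℕ) (a x : ℕ) (h1 : a ≤ x) (h2 : x ≤ m)
    (h3 : x ∉ occ) (h : ∀ j, a ≤ j → j < x → j ∈ occ) :
    parkStep m occ a = insert x occ := by
  have hx : x ∈ (Finset.Icc a m) \ occ := by simp [h1, h2, h3]
  have hne : ((Finset.Icc a m) \ occ).Nonempty := ⟨x, hx⟩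
  unfold parkStep
  rw [dif_pos hne]
  have : ((Finset.Icc a m) \ occ).min' hne = x := by
    apply le_antisymm
    · exact Finset.min'_le _ _ hx
    · apply Finset.le_min'
      intro y hy
      simp only [Finset.mem_sdiff, Finset.mem_Icc] at hy
      by_contra hlt
      exact hy.2 (h y hy.1.1 (by omega))
  rw [this]

theorem parkStep_cases (m : ℕ) (occ : Finset ℕ) (a : ℕ) :
    (∀ j, a ≤ j → j ≤ m → j ∈ occ) ∨
    (∃ x, a ≤ x ∧ x ≤ m ∧ x ∉ occ ∧ ∀ j, a ≤ j → j < x → j ∈ occ) := by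
  by_cases h : ∃ x, a ≤ x ∧ x ≤ m ∧ x ∉ occ
  · right
    classical
    refine ⟨Nat.find h, (Nat.find_spec h).1, (Nat.find_spec h).2.1, (Nat.find_spec h).2.2, ?_⟩
    intro j h1 h2
    by_contra h3
    exact Nat.find_min h h2 ⟨h1, by have := (Nat.find_spec h).2.1; omega, h3⟩
  · left
    push Not at h
    exact h

theorem occupied_append (m : ℕ) (L : List ℕ) (a : ℕ) :
    occupied m (L ++ [a]) = parkStep m (occupied m L) a := by
  simp [occupied]

theorem parkStep_card_le (m : ℕ) (occ : Finset ℕ) (a : ℕ) :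
    (parkStep m occ a).card ≤ occ.card + 1 := by
  rcases parkStep_cases m occ a with h | ⟨x, h1, h2, h3, h4⟩
  · rw [parkStep_full _ _ _ h]; omega
  · rw [parkStep_insert _ _ _ _ h1 h2 h3 h4]; exact Finset.card_insert_le _ _

theorem occupied_card_le (m : ℕ) (L : List ℕ) : (occupied m L).card ≤ L.length := by
  induction L using List.reverseRecOn with
  | nil => simp [occupied]
  | append_singleton L a ih =>
    rw [occupied_append]
    have := parkStep_card_le m (occupied m L) a
    simp; omega

theorem flaws_zero_iff (m : ℕ) (L : List ℕ) :
    flaws m L = 0 ↔ (occupied m L).card = L.length := by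
  have := occupied_card_le m L
  unfold flaws; omega

theorem occupied_subset (m : ℕ) (L : List ℕ) (hL : ∀ x ∈ L, 1 ≤ x) :
    occupied m L ⊆ Finset.Icc 1 m := by
  induction L using List.reverseRecOn with
  | nil => simp [occupied]
  | append_singleton L a ih =>
    rw [occupied_append]
    have ih' := ih (fun x hx => hL x (by simp [hx]))
    have ha := hL a (by simp)
    rcases parkStep_cases m (occupied m L) a with h | ⟨x, h1, h2, h3, h4⟩
    · rw [parkStep_full _ _ _ h]; exact ih'
    · rw [parkStep_insert _ _ _ _ h1 h2 h3 h4]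
      apply Finset.insert_subset _ ih'
      simp; omega

theorem l_mem (m l : ℕ) (L : List ℕ) (hl : l ≤ m) : l ∈ occupied m (l :: L) := by
  induction L using List.reverseRecOn with
  | nil =>
    have : occupied m [l] = parkStep m ∅ l := by simp [occupied]
    rw [this, parkStep_insert m ∅ l l le_rfl hl (by simp) (by intros; omega)]
    simp
  | append_singleton L a ih =>
    rw [← List.cons_append, occupied_append]
    rcases parkStep_cases m (occupied m (l :: L)) a with h | ⟨x, h1, h2, h3, h4⟩
    · rw [parkStep_full _ _ _ h]; exact ih
    · rw [parkStep_insert _ _ _ _ h1 h2 h3 h4]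
      simp [ih]

def lowL (l : ℕ) (L : List ℕ) : List ℕ := L.filter (fun x => x < l)
def highL (l : ℕ) (L : List ℕ) : List ℕ := L.filter (fun x => l < x)

theorem low_eq (m l : ℕ) (L : List ℕ) (hl1 : 1 ≤ l) (hl : l ≤ m) :
    (occupied m (l :: L)).filter (fun x => x < l) = occupied (l - 1) (lowL l L) := by
  induction L using List.reverseRecOn with
  | nil =>
    have : occupied m [l] = parkStep m ∅ l := by simp [occupied]
    rw [this, parkStep_insert m ∅ l l le_rfl hl (by simp) (by intros; omega)]
    ext x; simp [occupied, lowL]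
    omega
  | append_singleton L a ih =>
    have hm := l_mem m l L hl
    rw [← List.cons_append, occupied_append]
    have key : ∀ x, x ∈ occupied (l - 1) (lowL l L) ↔ x ∈ occupied m (l :: L) ∧ x < l := by
      intro x; rw [← ih]; simp
    by_cases ha : a < l
    · have e : lowL l (L ++ [a]) = lowL l L ++ [a] := by simp [lowL, ha]
      rw [e, occupied_append]
      rcases parkStep_cases (l - 1) (occupied (l - 1) (lowL l L)) a with h | ⟨x, h1, h2, h3, h4⟩
      · rw [parkStep_full _ _ _ h, ← ih]
        rcases parkStep_cases m (occupied m (l :: L)) a with h' | ⟨x, h1, h2, h3, h4⟩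
        · rw [parkStep_full _ _ _ h']
        · rw [parkStep_insert _ _ _ _ h1 h2 h3 h4, Finset.filter_insert, if_neg]
          intro hx
          exact h3 ((key x).1 (h x h1 (by omega))).1
      · rw [parkStep_insert _ _ _ _ h1 h2 h3 h4]
        rw [parkStep_insert m _ a x h1 (by omega)
          (fun hx => h3 ((key x).2 ⟨hx, by omega⟩))
          (fun j hj1 hj2 => ((key j).1 (h4 j hj1 hj2)).1)]
        rw [Finset.filter_insert, if_pos (by omega), ih]
    · have e : lowL l (L ++ [a]) = lowL l L := by simp [lowL]; omega
      rw [e, ← ih]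
      rcases parkStep_cases m (occupied m (l :: L)) a with h' | ⟨x, h1, h2, h3, h4⟩
      · rw [parkStep_full _ _ _ h']
      · rw [parkStep_insert _ _ _ _ h1 h2 h3 h4, Finset.filter_insert, if_neg (by omega)]

theorem high_eq (m l : ℕ) (L : List ℕ) (hl1 : 1 ≤ l) (hl : l ≤ m) (hL : l ∉ L)
    (hf : flaws (l - 1) (lowL l L) = 0) :
    (occupied m (l :: L)).filter (fun x => l < x) =
      (occupied (m - l) ((highL l L).map (fun x => x - l))).image (fun x => x + l) := by
  induction L using List.reverseRecOn with
  | nil =>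
    have : occupied m [l] = parkStep m ∅ l := by simp [occupied]
    rw [this, parkStep_insert m ∅ l l le_rfl hl (by simp) (by intros; omega)]
    ext x; simp [occupied, highL]
    omega
  | append_singleton L a ih =>
    have hm := l_mem m l L hl
    have hlow := low_eq m l L hl1 hl
    have key0 : ∀ x, x ∈ occupied (l - 1) (lowL l L) ↔ x ∈ occupied m (l :: L) ∧ x < l := by
      intro x; rw [← hlow]; simp
    simp only [List.mem_append, List.mem_singleton, not_or] at hL
    rw [← List.cons_append, occupied_append]
    by_cases ha : a < l
    · have e : lowL l (L ++ [a]) = lowL l L ++ [a] := by simp [lowL, ha]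
      have e2 : highL l (L ++ [a]) = highL l L := by simp [highL]; omega
      rw [flaws_zero_iff, e, occupied_append] at hf
      have hc := occupied_card_le (l - 1) (lowL l L)
      rw [e2]
      rcases parkStep_cases (l - 1) (occupied (l - 1) (lowL l L)) a with h | ⟨x, h1, h2, h3, h4⟩
      · rw [parkStep_full _ _ _ h] at hf
        simp at hf; omega
      · rw [parkStep_insert _ _ _ _ h1 h2 h3 h4, Finset.card_insert_of_notMem h3] at hf
        rw [← ih hL.1 (by rw [flaws_zero_iff]; simp at hf; omega)]
        rw [parkStep_insert m _ a x h1 (by omega)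
          (fun hx => h3 ((key0 x).2 ⟨hx, by omega⟩))
          (fun j hj1 hj2 => ((key0 j).1 (h4 j hj1 hj2)).1)]
        rw [Finset.filter_insert, if_neg (by omega)]
    · have ha' : l < a := by omega
      have e : lowL l (L ++ [a]) = lowL l L := by simp [lowL]; omega
      have e2 : highL l (L ++ [a]) = highL l L ++ [a] := by simp [highL, ha']
      rw [e] at hf
      have ih' := ih hL.1 hf
      rw [e2, List.map_append, List.map_singleton, occupied_append]
      set O := occupied (m - l) ((highL l L).map (fun x => x - l)) with hO
      have key : ∀ x, l < x → (x - l ∈ O ↔ x ∈ occupied m (l :: L)) := by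
        intro x hx
        have h1 : x ∈ (occupied m (l :: L)).filter (fun x => l < x) ↔
            x ∈ O.image (fun x => x + l) := by rw [ih']
        simp only [Finset.mem_filter, Finset.mem_image] at h1
        constructor
        · intro h; exact (h1.2 ⟨x - l, h, by omega⟩).1
        · intro h
          obtain ⟨y, hy, rfl⟩ := h1.1 ⟨h, hx⟩
          simpa using hy
      rcases parkStep_cases m (occupied m (l :: L)) a with h | ⟨x, h1, h2, h3, h4⟩
      · rw [parkStep_full _ _ _ h, parkStep_full _ _ _ _, ih']
        intro j hj1 hj2
        have := (key (j + l) (by omega)).2 (h _ (by omega) (by omega))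
        simpa using this
      · rw [parkStep_insert _ _ _ _ h1 h2 h3 h4,
          parkStep_insert (m - l) O (a - l) (x - l) (by omega) (by omega)
            (fun h => h3 ((key x (by omega)).1 h)) _]
        · rw [Finset.filter_insert, if_pos (by omega), ih', Finset.image_insert]
          congr 1; omega
        · intro j hj1 hj2
          have := (key (j + l) (by omega)).2 (h4 _ (by omega) (by omega))
          simpa using this

theorem len_split (l : ℕ) (L : List ℕ) :
    L.length = (lowL l L).length + L.count l + (highL l L).length := by
  induction L with
  | nil => simp [lowL, highL]
  | cons a L ih =>
    simp only [lowL, highL, List.filter_cons, List.count_cons, List.length_cons] at *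
    rcases lt_trichotomy a l with h | h | h
    · simp [h, h.ne]; split_ifs <;> simp at * <;> omega
    · simp [h]; omega
    · simp [h, h.ne']; split_ifs <;> simp at * <;> omega

theorem occ_split (l : ℕ) (S : Finset ℕ) (h : l ∈ S) :
    S.card = (S.filter (fun x => x < l)).card + 1 + (S.filter (fun x => l < x)).card := by
  have : S = (S.filter (fun x => x < l)) ∪ {l} ∪ (S.filter (fun x => l < x)) := by
    ext x
    simp only [Finset.mem_union, Finset.mem_filter, Finset.mem_singleton]
    constructor
    · intro hx; rcases lt_trichotomy x l with h | h | h <;> simp [*]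
    · rintro ((h' | h') | h')
      · exact h'.1
      · rw [h']; exact h
      · exact h'.1
  conv_lhs => rw [this]
  rw [Finset.card_union_of_disjoint, Finset.card_union_of_disjoint, Finset.card_singleton]
  · rw [Finset.disjoint_left]; intro x
    simp only [Finset.mem_filter, Finset.mem_singleton]; omega
  · rw [Finset.disjoint_left]; intro x
    simp only [Finset.mem_union, Finset.mem_filter, Finset.mem_singleton]; omega

theorem hstat_eq (m l : ℕ) (L : List ℕ) (hl1 : 1 ≤ l) (hl : l ≤ m) (hL : ∀ x ∈ L, 1 ≤ x) :
    hstat m (l :: L) = l - 1 - (occupied (l - 1) (lowL l L)).card := by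
  have hs : occupied (l - 1) (lowL l L) ⊆ Finset.Icc 1 (l - 1) :=
    occupied_subset _ _ (fun x hx => hL x (List.mem_of_mem_filter hx))
  have : (empties m (l :: L)).filter (fun x => x < l) =
      Finset.Icc 1 (l - 1) \ occupied (l - 1) (lowL l L) := by
    rw [← low_eq m l L hl1 hl]
    ext x
    simp only [empties, Finset.mem_filter, Finset.mem_sdiff, Finset.mem_Icc, not_and]
    constructor
    · rintro ⟨⟨⟨h1, h2⟩, h3⟩, h4⟩
      exact ⟨⟨h1, by omega⟩, fun h => absurd h h3⟩
    · rintro ⟨⟨h1, h2⟩, h3⟩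
      exact ⟨⟨⟨h1, by omega⟩, fun h => h3 h (by omega)⟩, by omega⟩
  change ((empties m (l :: L)).filter (fun x => x < l)).card = _
  rw [this, Finset.card_sdiff_of_subset hs]
  simp

theorem main_iff (n k l : ℕ) (L : List ℕ) (hl1 : k + 1 ≤ l) (hl2 : l ≤ n + k)
    (hlen : L.length + 1 = n) (hL : ∀ x ∈ L, 1 ≤ x) :
    (flaws (n + k) (l :: L) = 0 ∧
        taustat (l :: L) = l - hstat (n + k) (l :: L) ∧
        nstat (l :: L) = 1 ∧ hstat (n + k) (l :: L) = k) ↔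
    (l ∉ L ∧ (lowL l L).length = l - k - 1 ∧ (highL l L).length = n + k - l ∧
      flaws (l - 1) (lowL l L) = 0 ∧
      flaws (n + k - l) ((highL l L).map (fun x => x - l)) = 0) := by
  have hs := hstat_eq (n + k) l L (by omega) hl2 hL
  have hn : nstat (l :: L) = L.count l + 1 := by simp [nstat]
  have ht : taustat (l :: L) = (lowL l L).length + 1 := by
    simp [taustat, lowL, List.countP_eq_length_filter]
    rfl
  have hsp := len_split l L
  have ho := occ_split l _ (l_mem (n + k) l L hl2)
  rw [low_eq _ _ _ (by omega) hl2] at ho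
  have hc := occupied_card_le (l - 1) (lowL l L)
  have hcount : l ∉ L ↔ L.count l = 0 := List.count_eq_zero.symm
  have hsub : occupied (l - 1) (lowL l L) ⊆ Finset.Icc 1 (l - 1) :=
    occupied_subset _ _ (fun x hx => hL x (List.mem_of_mem_filter hx))
  have hsc := Finset.card_le_card hsub
  simp only [Nat.card_Icc] at hsc
  have hh : l ∉ L → flaws (l - 1) (lowL l L) = 0 →
    ((occupied (n + k) (l :: L)).filter (fun x => l < x)).card =
    (occupied (n + k - l) ((highL l L).map (fun x => x - l))).card := by
    intro h1 h2
    rw [high_eq _ _ _ (by omega) hl2 h1 h2, Finset.card_image_of_injective]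
    intro x y; simp
  simp only [flaws_zero_iff, hcount, List.length_cons, List.length_map] at *
  rw [hn, ht]
  constructor
  · rintro ⟨h1, h2, h3, h4⟩
    have h5 : L.count l = 0 := by omega
    have h6 : (occupied (l - 1) (lowL l L)).card = (lowL l L).length := by omega
    have := hh h5 h6
    omega
  · rintro ⟨h1, h2, h3, h4, h5⟩
    have := hh h1 h4
    omega

/-- shuffles -/
def sh : List ℕ → List ℕ → Finset (List ℕ)
  | [], B => {B}
  | a :: A, [] => {a :: A}
  | a :: A, b :: B => (sh A (b :: B)).image (List.cons a) ∪ (sh (a :: A) B).image (List.cons b)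
termination_by A B => A.length + B.length

theorem sh_card (l : ℕ) (A B : List ℕ) (hA : ∀ x ∈ A, x < l) (hB : ∀ x ∈ B, l < x) :
    (sh A B).card = (A.length + B.length).choose A.length := by
  induction A, B using sh.induct with
  | case1 B => simp [sh]
  | case2 a A => simp [sh]
  | case3 a A b B ih1 ih2 =>
    rw [sh, Finset.card_union_of_disjoint, Finset.card_image_of_injective _ (List.cons_injective),
      Finset.card_image_of_injective _ (List.cons_injective),
      ih1 (fun x hx => hA x (by simp [hx])) hB, ih2 hA (fun x hx => hB x (by simp [hx]))]
    · simp only [List.length_cons]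
      rw [show A.length + 1 + (B.length + 1) = (A.length + (B.length + 1)) + 1 by ring,
        Nat.choose_succ_succ]
      congr 2; ring
    · rw [Finset.disjoint_left]
      intro x; simp only [Finset.mem_image]
      rintro ⟨y, _, rfl⟩ ⟨z, _, h⟩
      have h1 := hA a (by simp)
      have h2 := hB b (by simp)
      have := (List.cons.inj h).1
      omega

theorem mem_sh (l : ℕ) (A B L : List ℕ) (hA : ∀ x ∈ A, x < l) (hB : ∀ x ∈ B, l < x) :
    L ∈ sh A B ↔ l ∉ L ∧ lowL l L = A ∧ highL l L = B := by
  induction A, B using sh.induct generalizing L with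
  | case1 B =>
    simp only [sh, Finset.mem_singleton]
    constructor
    · rintro rfl
      refine ⟨fun h => by have := hB _ h; omega, ?_, ?_⟩
      · simp only [lowL, List.filter_eq_nil_iff]; intro x hx; have := hB x hx; simp; omega
      · simp only [highL, List.filter_eq_self]; intro x hx; have := hB x hx; simpa
    · rintro ⟨h1, h2, rfl⟩
      symm
      simp only [highL, List.filter_eq_self]
      simp only [lowL, List.filter_eq_nil_iff] at h2
      intro x hx
      have := h2 x hx
      have : x ≠ l := by rintro rfl; exact h1 hx
      simp at *; omega
  | case2 a A =>
    simp only [sh, Finset.mem_singleton]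
    generalize a :: A = A at *
    constructor
    · rintro rfl
      refine ⟨fun h => by have := hA _ h; omega, ?_, ?_⟩
      · simp only [lowL, List.filter_eq_self]; intro x hx; have := hA x hx; simpa
      · simp only [highL, List.filter_eq_nil_iff]; intro x hx; have := hA x hx; simp; omega
    · rintro ⟨h1, rfl, h2⟩
      symm
      simp only [lowL, List.filter_eq_self]
      simp only [highL, List.filter_eq_nil_iff] at h2
      intro x hx
      have := h2 x hx
      have : x ≠ l := by rintro rfl; exact h1 hx
      simp at *; omega
  | case3 a A b B ih1 ih2 =>
    have ih1 := fun L => ih1 L (fun x hx => hA x (by simp [hx])) hB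
    have ih2 := fun L => ih2 L hA (fun x hx => hB x (by simp [hx]))
    have ha := hA a (by simp)
    have hb := hB b (by simp)
    rw [sh]
    simp only [Finset.mem_union, Finset.mem_image, ih1, ih2]
    constructor
    · rintro (⟨y, ⟨h1, h2, h3⟩, rfl⟩ | ⟨y, ⟨h1, h2, h3⟩, rfl⟩)
      · simp only [lowL, highL] at *
        refine ⟨?_, ?_, ?_⟩
        · simp [h1]; omega
        · rw [List.filter_cons, if_pos (by simpa using ha), h2]
        · rw [List.filter_cons, if_neg (by simp; omega), h3]
      · simp only [lowL, highL] at *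
        refine ⟨?_, ?_, ?_⟩
        · simp [h1]; omega
        · rw [List.filter_cons, if_neg (by simp; omega), h2]
        · rw [List.filter_cons, if_pos (by simpa using hb), h3]
    · rintro ⟨h1, h2, h3⟩
      cases L with
      | nil => simp [lowL] at h2
      | cons c L =>
        simp only [List.mem_cons, not_or] at h1
        simp only [lowL, highL] at *
        rcases lt_or_gt_of_ne h1.1 with h | h
        · right
          rw [List.filter_cons, if_neg (by simp; omega)] at h2
          rw [List.filter_cons, if_pos (by simpa using h)] at h3
          obtain ⟨rfl, h3'⟩ := List.cons.inj h3
          exact ⟨L, ⟨h1.2, h2, h3'⟩, rfl⟩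
        · left
          rw [List.filter_cons, if_neg (by simp; omega)] at h3
          rw [List.filter_cons, if_pos (by simpa using h)] at h2
          obtain ⟨rfl, h2'⟩ := List.cons.inj h2
          exact ⟨L, ⟨h1.2, h2', h3⟩, rfl⟩

theorem prefList_eq {n s : ℕ} (f : Fin n → Fin s) :
    prefList f = List.ofFn (fun i => (f i : ℕ) + 1) := by
  have h : ∀ M : List (Fin s), (do let a ← M; pure (a : ℕ) : List ℕ) = M.map (fun a : Fin s => (a : ℕ)) := by
    intro M
    induction M with
    | nil => rfl
    | cons a M ih => simpa using ih
  unfold prefList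
  rw [h, List.map_map, List.map_ofFn]
  rfl

theorem prefList_inj {n s : ℕ} : Function.Injective (prefList : (Fin n → Fin s) → List ℕ) := by
  intro f g h
  rw [prefList_eq, prefList_eq] at h
  have h := List.ofFn_injective h
  funext i
  have := congrFun h i
  apply Fin.ext
  simpa using this

theorem prefList_range {n s : ℕ} (L : List ℕ) :
    (∃ f : Fin n → Fin s, prefList f = L) ↔ L.length = n ∧ ∀ x ∈ L, 1 ≤ x ∧ x ≤ s := by
  constructor
  · rintro ⟨f, rfl⟩
    rw [prefList_eq]
    refine ⟨by simp, ?_⟩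
    intro x hx
    obtain ⟨i, rfl⟩ := List.mem_ofFn.1 hx
    have := (f i).2; omega
  · rintro ⟨rfl, h⟩
    refine ⟨fun i => ⟨L[i] - 1, by have := h L[i] (by simp); omega⟩, ?_⟩
    rw [prefList_eq]
    apply List.ext_getElem
    · simp
    · intro i h1 h2
      have := h L[i] (by simp)
      simp; omega

def PF (n m s : ℕ) : Finset (List ℕ) :=
  (Finset.univ.filter (fun f : Fin n → Fin s => flaws m (prefList f) = 0)).image prefList

theorem PF_card (n m s : ℕ) : (PF n m s).card = p n m s 0 :=
  Finset.card_image_of_injective _ prefList_inj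

theorem mem_PF (n m s : ℕ) (L : List ℕ) :
    L ∈ PF n m s ↔ L.length = n ∧ (∀ x ∈ L, 1 ≤ x ∧ x ≤ s) ∧ flaws m L = 0 := by
  rw [← and_assoc, ← prefList_range (n := n) (s := s)]
  simp only [PF, Finset.mem_image, Finset.mem_filter, Finset.mem_univ, true_and]
  constructor
  · rintro ⟨f, h, rfl⟩; exact ⟨⟨f, rfl⟩, h⟩
  · rintro ⟨⟨f, rfl⟩, h⟩; exact ⟨f, h, rfl⟩

theorem map_sub_add (l : ℕ) (B : List ℕ) (h : ∀ x ∈ B, l < x) :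
    (B.map (fun x => x - l)).map (fun x => x + l) = B := by
  rw [List.map_map]
  conv_rhs => rw [← List.map_id B]
  apply List.map_congr_left
  intro x hx; have := h x hx; simp; omega

theorem map_add_sub (l : ℕ) (B : List ℕ) :
    (B.map (fun x => x + l)).map (fun x => x - l) = B := by
  rw [List.map_map]
  conv_rhs => rw [← List.map_id B]
  apply List.map_congr_left
  intro x hx; simp

/-- Lemma 3.5: for `k ≥ 0` and `k+1 ≤ l ≤ n+k`, the number of parking functions `α`
of length `n` with `n+k` spaces such that `a₁ = l`, `τ_α = l - h_α`, `n_α = 1` and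
`h_α = k` equals `C(n-1, l-k-1) · p_{l-k-1,l-1;≤l-1} · p_{n+k-l}`. -/
theorem stmt6 (n k l : ℕ) (hn : 1 ≤ n) (hl1 : k + 1 ≤ l) (hl2 : l ≤ n + k) :
    (Finset.univ.filter (fun f : Fin n → Fin (n + k) =>
        flaws (n + k) (prefList f) = 0 ∧ (prefList f).head? = some l ∧
        taustat (prefList f) = l - hstat (n + k) (prefList f) ∧
        nstat (prefList f) = 1 ∧ hstat (n + k) (prefList f) = k)).card =
      Nat.choose (n - 1) (l - k - 1) * p (l - k - 1) (l - 1) (l - 1) 0 *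
        p (n + k - l) (n + k - l) (n + k - l) 0 := by
  rw [← Finset.card_image_of_injective _ prefList_inj]
  have key : Finset.image prefList (Finset.univ.filter (fun f : Fin n → Fin (n + k) =>
        flaws (n + k) (prefList f) = 0 ∧ (prefList f).head? = some l ∧
        taustat (prefList f) = l - hstat (n + k) (prefList f) ∧
        nstat (prefList f) = 1 ∧ hstat (n + k) (prefList f) = k)) =
      (PF (l - k - 1) (l - 1) (l - 1) ×ˢ PF (n + k - l) (n + k - l) (n + k - l)).biUnion
        (fun q => (sh q.1 (q.2.map (fun x => x + l))).image (List.cons l)) := by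
    ext M
    simp only [Finset.mem_image, Finset.mem_filter, Finset.mem_univ, true_and,
      Finset.mem_biUnion, Finset.mem_product, mem_PF, Prod.exists]
    constructor
    · rintro ⟨f, ⟨h1, h2, h3, h4, h5⟩, rfl⟩
      obtain ⟨hlen, hb⟩ := (prefList_range (n := n) (s := n + k) (prefList f)).1 ⟨f, rfl⟩
      generalize prefList f = M at *
      cases M with
      | nil => simp at h2
      | cons a L =>
        obtain rfl : a = l := by simpa using h2
        have hb' : ∀ x ∈ L, 1 ≤ x ∧ x ≤ n + k := fun x hx => hb x (by simp [hx])
        obtain ⟨g1, g2, g3, g4, g5⟩ := (main_iff n k a L hl1 hl2 (by simpa using hlen)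
          (fun x hx => (hb' x hx).1)).1 ⟨h1, h3, h4, h5⟩
        have hlo : ∀ x ∈ lowL a L, x ∈ L ∧ x < a := by intro x hx; simpa [lowL] using hx
        have hhi : ∀ x ∈ highL a L, x ∈ L ∧ a < x := by intro x hx; simpa [highL] using hx
        refine ⟨lowL a L, (highL a L).map (fun x => x - a), ⟨⟨g2, ?_, g4⟩, by simpa using g3, ?_, g5⟩,
          L, ?_, rfl⟩
        · intro x hx
          have h1 := hlo x hx
          have h2 := hb' x h1.1
          omega
        · intro x hx
          obtain ⟨y, hy, rfl⟩ := List.mem_map.1 hx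
          have h1 := hhi y hy
          have h2 := hb' y h1.1
          omega
        · rw [map_sub_add _ _ (fun x hx => (hhi x hx).2),
            mem_sh a _ _ _ (fun x hx => (hlo x hx).2) (fun x hx => (hhi x hx).2)]
          exact ⟨g1, rfl, rfl⟩
    · rintro ⟨A, B, ⟨⟨a1, a2, a3⟩, b1, b2, b3⟩, L, hL, rfl⟩
      rw [mem_sh l _ _ _ (fun x hx => by have := a2 x hx; omega) (fun x hx => by
        obtain ⟨y, hy, rfl⟩ := List.mem_map.1 hx
        have := b2 y hy; omega)] at hL
      obtain ⟨c1, c2, c3⟩ := hL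
      have hsp := len_split l L
      have hc := List.count_eq_zero.2 c1
      have hlen : L.length + 1 = n := by
        rw [hsp, c2, c3, hc, List.length_map]; omega
      have hb : ∀ x ∈ L, 1 ≤ x ∧ x ≤ n + k := by
        intro x hx
        have hne : x ≠ l := by rintro rfl; exact c1 hx
        rcases lt_or_gt_of_ne hne with h | h
        · have : x ∈ lowL l L := by simp [lowL, hx, h]
          rw [c2] at this
          have := a2 x this; omega
        · have : x ∈ highL l L := by simp [highL, hx, h]
          rw [c3] at this
          obtain ⟨y, hy, rfl⟩ := List.mem_map.1 this
          have := b2 y hy; omega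
      obtain ⟨f, hf⟩ := (prefList_range (n := n) (s := n + k) (l :: L)).2 ⟨by simpa using hlen, by
        intro x hx
        rcases List.mem_cons.1 hx with rfl | hx
        · omega
        · exact hb x hx⟩
      refine ⟨f, ?_, hf⟩
      rw [hf]
      obtain ⟨h1, h3, h4, h5⟩ := (main_iff n k l L hl1 hl2 hlen (fun x hx => (hb x hx).1)).2
        ⟨c1, by rw [c2, a1], by rw [c3, List.length_map, b1], by rw [c2, a3],
          by rw [c3, map_add_sub, b3]⟩
      exact ⟨h1, by simp, h3, h4, h5⟩
  rw [key]
  have hq : ∀ q ∈ PF (l - k - 1) (l - 1) (l - 1) ×ˢ PF (n + k - l) (n + k - l) (n + k - l),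
      (∀ x ∈ q.1, x < l) ∧ (∀ x ∈ q.2.map (fun x => x + l), l < x) ∧ q.1.length = l - k - 1 ∧
        q.2.length = n + k - l := by
    rintro ⟨A, B⟩ hq
    simp only [Finset.mem_product, mem_PF] at hq
    obtain ⟨⟨a1, a2, a3⟩, b1, b2, b3⟩ := hq
    refine ⟨fun x hx => by have := a2 x hx; omega, fun x hx => ?_, a1, b1⟩
    obtain ⟨y, hy, rfl⟩ := List.mem_map.1 hx
    have := b2 y hy; omega
  rw [Finset.card_biUnion]
  · rw [Finset.sum_congr rfl (g := fun _ => Nat.choose (n - 1) (l - k - 1))]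
    · rw [Finset.sum_const, Finset.card_product, PF_card, PF_card, smul_eq_mul]; ring
    · intro q h
      obtain ⟨h1, h2, h3, h4⟩ := hq q h
      rw [Finset.card_image_of_injective _ (List.cons_injective), sh_card l _ _ h1 h2,
        List.length_map, h3, h4]
      congr 1; omega
  · intro q h q' h' hne
    obtain ⟨h1, h2, -, -⟩ := hq q h
    obtain ⟨h1', h2', -, -⟩ := hq q' h'
    refine Finset.disjoint_left.2 ?_
    intro M hM hM'
    apply hne
    obtain ⟨L, hL, rfl⟩ := Finset.mem_image.1 hM
    obtain ⟨L', hL', e⟩ := Finset.mem_image.1 hM'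
    obtain rfl := (List.cons.inj e).2
    rw [mem_sh l _ _ _ h1 h2] at hL
    rw [mem_sh l _ _ _ h1' h2'] at hL'
    apply Prod.ext
    · rw [← hL.2.1, hL'.2.1]
    · rw [← map_add_sub l q.2, ← map_add_sub l q'.2, ← hL.2.2, hL'.2.2]
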